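/- Let T be a finite tree that is an iso-unique zero forcing graph and let 𝒫 be a minimum path cover of T. If some path P ∈ 𝒫 consists of a single vertex x, then the neighbor of x in T is the middle vertex of a path R ∈ 𝒫 that has exactly three vertices (i.e., R is isomorphic to P_3 and the neighbor of x is its center). -/

import Mathlib

/-- The set of vertices that eventually become active in the zero forcing process
started from the set `S`: an active vertex whose neighbors, except exactly one,
are all active, forces the remaining one to become active. -/
inductive ZFClosed {V : Type*} (G : SimpleGraph V) (S : Set V) : V → Prop
  | init (v : V) (hv : v ∈ S) : ZFClosed G S v
  | force (u v : V) (hu : ZFClosed G S u) (huv : G.Adj u v)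
      (hrest : ∀ w : V, G.Adj u w → w ≠ v → ZFClosed G S w) : ZFClosed G S v

/-- `S` is a zero forcing set of `G` if the zero forcing process started at `S`
activates all vertices. -/
def IsZeroForcingSet {V : Type*} (G : SimpleGraph V) (S : Set V) : Prop :=
  ∀ v : V, ZFClosed G S v

/-- A minimum zero forcing set: a zero forcing set of minimum cardinality. -/
def IsMinZeroForcingSet {V : Type*} (G : SimpleGraph V) (S : Set V) : Prop :=
  IsZeroForcingSet G S ∧ ∀ S' : Set V, IsZeroForcingSet G S' → S.ncard ≤ S'.ncard

/-- `G` is iso-unique zero forcing: any two minimum zero forcing sets are mapped to each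
other by some graph automorphism. -/
def IsoUniqueZF {V : Type*} (G : SimpleGraph V) : Prop :=
  ∀ S₁ S₂ : Set V, IsMinZeroForcingSet G S₁ → IsMinZeroForcingSet G S₂ →
    ∃ φ : G ≃g G, ⇑φ '' S₁ = S₂

/-- A nonempty list of distinct vertices forming an induced path of `G`:
consecutive vertices are adjacent and non-consecutive vertices are non-adjacent. -/
def IsInducedPath {V : Type*} (G : SimpleGraph V) (l : List V) : Prop :=
  l ≠ [] ∧ l.Nodup ∧
  (∀ i j : Fin l.length, (i : ℕ) + 1 = (j : ℕ) → G.Adj (l.get i) (l.get j)) ∧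
  (∀ i j : Fin l.length, (i : ℕ) + 1 < (j : ℕ) → ¬ G.Adj (l.get i) (l.get j))

/-- A path cover of `G`: a set of pairwise vertex-disjoint induced paths covering all
vertices of `G`. -/
def IsPathCover {V : Type*} [DecidableEq V] (G : SimpleGraph V) (P : Finset (List V)) : Prop :=
  (∀ l ∈ P, IsInducedPath G l) ∧
  (∀ v : V, ∃ l ∈ P, v ∈ l) ∧
  (∀ l ∈ P, ∀ l' ∈ P, l ≠ l' → ∀ v : V, v ∈ l → v ∉ l')

/-- A minimum path cover: a path cover with the fewest possible number of paths. -/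
def IsMinPathCover {V : Type*} [DecidableEq V] (G : SimpleGraph V)
    (P : Finset (List V)) : Prop :=
  IsPathCover G P ∧ ∀ Q : Finset (List V), IsPathCover G Q → P.card ≤ Q.card

/-- `x` is an interior vertex of some path of the cover `P`, i.e. it belongs to a path
of `P` and is not an end-vertex of that path. -/
def InteriorIn {V : Type*} (P : Finset (List V)) (x : V) : Prop :=
  ∃ l ∈ P, ∃ h : l ≠ [], x ∈ l ∧ x ≠ l.head h ∧ x ≠ l.getLast h

open SimpleGraph

section Acyclic

variable {V : Type*} {T : SimpleGraph V}

theorem SimpleGraph.IsAcyclic.isPath_cons (hT : T.IsAcyclic) {u w z : V} {p : T.Walk u w}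
    (hp : p.IsPath) (h : T.Adj z u) (hz : z ≠ p.snd) : (Walk.cons h p).IsPath :=
  (Walk.cons_isPath_iff h p).2 ⟨hp, fun hm => hz (hT.eq_snd_of_adj_start hp h.symm hm)⟩

theorem SimpleGraph.IsAcyclic.not_adj_of_isChain (hT : T.IsAcyclic) {a b c : V} {t : List V}
    (hn : (a :: b :: t).Nodup) (hc : (a :: b :: t).IsChain T.Adj) (hm : c ∈ t) : ¬ T.Adj a c := by
  intro hadj
  obtain ⟨p, hp⟩ : ∃ p : T.Walk b ((b :: t).getLast (by simp)), p.support = b :: t :=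
    ⟨Walk.ofSupport (b :: t) (by simp) hc.of_cons, Walk.support_ofSupport _ _⟩
  have hpath : (Walk.cons hc.rel p).IsPath := by
    rwa [Walk.isPath_def, Walk.support_cons, hp]
  have hcb := hT.eq_snd_of_adj_start hpath hadj (by simp [hp, hm])
  rw [Walk.snd_cons] at hcb
  subst hcb
  simp [hm] at hn

theorem isInducedPath_iff (hT : T.IsAcyclic) {l : List V} :
    IsInducedPath T l ↔ l ≠ [] ∧ l.Nodup ∧ l.IsChain T.Adj := by
  constructor
  · rintro ⟨h1, h2, h3, -⟩
    refine ⟨h1, h2, List.isChain_iff_getElem.2 fun i hi => ?_⟩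
    simpa using h3 ⟨i, by omega⟩ ⟨i + 1, hi⟩ rfl
  · rintro ⟨h1, h2, h3⟩
    refine ⟨h1, h2, ?_, ?_⟩
    · rintro ⟨i, hi⟩ ⟨j, hj⟩ hij
      simp only at hij
      subst hij
      simpa using List.isChain_iff_getElem.1 h3 i hj
    · rintro ⟨i, hi⟩ ⟨j, hj⟩ hij hadj
      simp only [List.get_eq_getElem] at hij hadj
      have hd : l.drop i = l[i] :: l[i + 1] :: l.drop (i + 2) := by
        rw [List.drop_eq_getElem_cons hi, List.drop_eq_getElem_cons (by omega)]
      refine hT.not_adj_of_isChain (hd ▸ h2.sublist (List.drop_sublist _ _)) (hd ▸ h3.drop i) ?_ hadj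
      rw [List.mem_iff_getElem]
      exact ⟨j - (i + 2), by simp; omega, by simp; congr 1; omega⟩

/-- In a finite graph one cannot keep extending paths forever. -/
theorem SimpleGraph.false_of_extend [Fintype V]
    (Q : ∀ u w : V, T.Walk u w → Prop)
    (hpath : ∀ u w p, Q u w p → p.IsPath)
    (hext : ∀ u w p, Q u w p → ∃ u' w', ∃ p' : T.Walk u' w', Q u' w' p' ∧ p.length < p'.length)
    {u w : V} {p : T.Walk u w} (h : Q u w p) : False := by
  have key : ∀ n : ℕ, ∃ u w, ∃ p : T.Walk u w, Q u w p ∧ n ≤ p.length := by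
    intro n
    induction n with
    | zero => exact ⟨u, w, p, h, Nat.zero_le _⟩
    | succ n ih =>
      obtain ⟨u, w, p, hq, hn⟩ := ih
      obtain ⟨u', w', p', hq', hn'⟩ := hext u w p hq
      exact ⟨u', w', p', hq', by omega⟩
  obtain ⟨u, w, p, hq, hn⟩ := key (Fintype.card V)
  exact absurd (hpath _ _ _ hq).length_lt (by omega)

theorem isZeroForcingSet_of_rel [Fintype V] (hT : T.IsAcyclic) (S : Set V) (R : V → V → Prop)
    (hadj : ∀ a b, R a b → T.Adj a b) (huniq : ∀ a b c, R a b → R a c → b = c)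
    (hasymm : ∀ a b, R a b → ¬ R b a) (hpred : ∀ v, v ∉ S → ∃ a, R a v) :
    IsZeroForcingSet T S := by
  intro v
  by_contra hv
  refine SimpleGraph.false_of_extend (T := T)
    (fun u w p => p.IsPath ∧ ¬ ZFClosed T S u ∧ ¬ R p.snd u) (fun _ _ _ h => h.1) ?_
    (p := (Walk.nil : T.Walk v v)) ⟨Walk.IsPath.nil, hv, fun h => (hadj _ _ h).ne (by simp)⟩
  rintro z w p ⟨hp, hz, hR⟩
  obtain ⟨u, hu⟩ := hpred z fun h => hz (.init z h)
  have huz := hadj _ _ hu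
  have hp' : (Walk.cons huz p).IsPath := hT.isPath_cons hp huz fun h => hR (h ▸ hu)
  by_cases hua : ZFClosed T S u
  · have : ∃ w', T.Adj u w' ∧ w' ≠ z ∧ ¬ ZFClosed T S w' := by
      by_contra! hcon
      exact hz (.force u z hua huz hcon)
    obtain ⟨w', hw', hne, hwa⟩ := this
    refine ⟨w', w, Walk.cons hw'.symm (Walk.cons huz p),
      ⟨hT.isPath_cons hp' _ (by simpa using hne), hwa, ?_⟩, by simp⟩
    simp only [Walk.snd_cons]
    exact fun h => hne (huniq _ _ _ h hu)
  · refine ⟨u, w, Walk.cons huz p, ⟨hp', hua, ?_⟩, by simp⟩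
    simp only [Walk.snd_cons]
    exact hasymm _ _ hu

theorem List.IsChain.reverse_adj {l : List V} (h : l.IsChain T.Adj) :
    l.reverse.IsChain T.Adj :=
  List.isChain_reverse.2 (h.imp fun _ _ h => h.symm)

/-- `b` is the image of `a` under an automorphism of `T`. -/
def SameOrbit (T : SimpleGraph V) (a b : V) : Prop := ∃ φ : T ≃g T, φ a = b

theorem SameOrbit.symm {a b : V} : SameOrbit T a b → SameOrbit T b a := by
  rintro ⟨φ, rfl⟩
  exact ⟨φ.symm, by simp⟩

theorem SameOrbit.trans {a b c : V} : SameOrbit T a b → SameOrbit T b c → SameOrbit T a c := by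
  rintro ⟨φ, rfl⟩ ⟨ψ, rfl⟩
  exact ⟨φ.trans ψ, rfl⟩

end Acyclic

section PathCover

variable {V : Type*} [DecidableEq V] {T : SimpleGraph V}

/-- The set of first vertices of the lists in `P`. -/
def headSet (P : Finset (List V)) : Set V := {v | ∃ l ∈ P, l.head? = some v}

theorem ncard_headSet_le (P : Finset (List V)) : (headSet P).ncard ≤ P.card := by
  have h : some '' headSet P ⊆ (P.image List.head? : Finset (Option V)) := by
    rintro _ ⟨v, ⟨l, hl, hv⟩, rfl⟩
    simpa using ⟨l, hl, hv⟩
  have h1 := Set.ncard_le_ncard h (Finset.finite_toSet _)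
  rw [Set.ncard_image_of_injective _ (Option.some_injective V), Set.ncard_coe_finset] at h1
  exact h1.trans Finset.card_image_le

theorem IsPathCover.eq_of_mem {P : Finset (List V)} (hP : IsPathCover T P) {l l' : List V}
    (hl : l ∈ P) (hl' : l' ∈ P) {v : V} (hv : v ∈ l) (hv' : v ∈ l') : l = l' := by
  by_contra hne
  exact hP.2.2 l hl l' hl' hne v hv hv'

theorem IsPathCover.isZeroForcingSet [Fintype V] (hT : T.IsAcyclic) {P : Finset (List V)}
    (hP : IsPathCover T P) : IsZeroForcingSet T (headSet P) := by
  refine isZeroForcingSet_of_rel hT _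
    (fun a b => ∃ l ∈ P, ∃ i : ℕ, l[i]? = some a ∧ l[i + 1]? = some b) ?_ ?_ ?_ ?_
  · rintro a b ⟨l, hl, i, ha, hb⟩
    obtain ⟨hi, rfl⟩ := List.getElem?_eq_some_iff.1 ha
    obtain ⟨hi', rfl⟩ := List.getElem?_eq_some_iff.1 hb
    exact (hP.1 l hl).2.2.1 ⟨i, hi⟩ ⟨i + 1, hi'⟩ rfl
  · rintro a b c ⟨l, hl, i, ha, hb⟩ ⟨l', hl', j, ha', hb'⟩
    obtain rfl := hP.eq_of_mem hl hl' (List.mem_of_getElem? ha) (List.mem_of_getElem? ha')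
    have hij : i = j := (List.getElem?_inj (List.getElem?_eq_some_iff.1 ha).1 (hP.1 l hl).2.1).1
      (ha.trans ha'.symm)
    subst hij
    simpa [hb] using hb'
  · rintro a b ⟨l, hl, i, ha, hb⟩ ⟨l', hl', j, hb', ha'⟩
    obtain rfl := hP.eq_of_mem hl hl' (List.mem_of_getElem? ha) (List.mem_of_getElem? ha')
    have h1 : i = j + 1 := (List.getElem?_inj (List.getElem?_eq_some_iff.1 ha).1 (hP.1 l hl).2.1).1
      (ha.trans ha'.symm)
    have h2 : i + 1 = j := (List.getElem?_inj (List.getElem?_eq_some_iff.1 hb).1 (hP.1 l hl).2.1).1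
      (hb.trans hb'.symm)
    omega
  · intro v hv
    obtain ⟨l, hl, hvl⟩ := hP.2.1 v
    obtain ⟨i, hi⟩ := List.mem_iff_getElem?.1 hvl
    cases i with
    | zero => exact absurd ⟨l, hl, by simpa [List.head?_eq_getElem?] using hi⟩ hv
    | succ i =>
      have hlt := (List.getElem?_eq_some_iff.1 hi).1
      exact ⟨l[i], l, hl, i, by simp, hi⟩

/-- Forcing chains of the zero forcing process: reversed, they form a path cover. -/
theorem IsZeroForcingSet.exists_isPathCover [Fintype V] (hT : T.IsAcyclic) {S : Set V}
    (hS : IsZeroForcingSet T S) :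
    ∃ Q : Finset (List V), IsPathCover T Q ∧ Q.card ≤ S.ncard := by
  classical
  have key : ∀ (n : ℕ) (A : Finset V) (Q : Finset (List V)), Aᶜ.card = n → S ⊆ A →
      (∀ l ∈ Q, l ≠ [] ∧ l.Nodup ∧ l.IsChain T.Adj) →
      (∀ v, v ∈ A ↔ ∃ l ∈ Q, v ∈ l) →
      (∀ l ∈ Q, ∀ l' ∈ Q, l ≠ l' → ∀ v : V, v ∈ l → v ∉ l') →
      (∀ l ∈ Q, ∀ v ∈ l.tail, ∀ w, T.Adj v w → w ∈ A) →
      ∃ Q' : Finset (List V), IsPathCover T Q' ∧ Q'.card ≤ Q.card := by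
    intro n
    induction n with
    | zero =>
      intro A Q hn _ h1 h2 h3 _
      have hA : A = Finset.univ := by simpa using hn
      exact ⟨Q, ⟨fun l hl => (isInducedPath_iff hT).2 (h1 l hl),
        fun v => (h2 v).1 (by simp [hA]), h3⟩, le_rfl⟩
    | succ n ih =>
      intro A Q hn hSA h1 h2 h3 h4
      obtain ⟨u, v, hu, hv, huv, hrest⟩ : ∃ u v, u ∈ A ∧ v ∉ A ∧ T.Adj u v ∧
          ∀ w, T.Adj u w → w ≠ v → w ∈ A := by
        by_contra! hcon
        have hall : ∀ v, ZFClosed T S v → v ∈ A := by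
          intro v hv
          induction hv with
          | init v hv => exact hSA hv
          | force u v _ huv _ hu hr =>
            by_contra hvA
            obtain ⟨w, hw, hwv, hwA⟩ := hcon u v hu hvA huv
            exact hwA (hr w hw hwv)
        have : Aᶜ = ∅ := by
          ext v
          simpa using hall v (hS v)
        simp [this] at hn
      obtain ⟨l, hl, hul⟩ := (h2 u).1 hu
      obtain ⟨t, rfl⟩ : ∃ t, l = u :: t := by
        cases l with
        | nil => simp at hul
        | cons a t =>
          rcases List.mem_cons.1 hul with rfl | h
          · exact ⟨t, rfl⟩
          · exact absurd (h4 _ hl u h v huv) hv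
      have hvl : ∀ l ∈ Q, v ∉ l := fun l hl h => hv ((h2 v).2 ⟨l, hl, h⟩)
      obtain ⟨Q', hQ', hcard⟩ := ih (insert v A) (insert (v :: u :: t) (Q.erase (u :: t)))
        (by
          have := Finset.card_compl_add_card A
          have := Finset.card_compl_add_card (insert v A)
          rw [Finset.card_insert_of_notMem hv] at this
          omega)
        (hSA.trans (by simp))
        (by
          intro l' hl'
          rcases Finset.mem_insert.1 hl' with rfl | hl'
          · obtain ⟨-, hnd, hch⟩ := h1 _ hl
            exact ⟨by simp, List.nodup_cons.2 ⟨hvl _ hl, hnd⟩,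
              List.isChain_cons_cons.2 ⟨huv.symm, hch⟩⟩
          · exact h1 _ (Finset.mem_of_mem_erase hl'))
        (by
          intro w
          simp only [Finset.mem_insert, Finset.mem_erase, h2 w, or_and_right, exists_or,
            exists_eq_left]
          constructor
          · rintro (rfl | ⟨l', hl', hw⟩)
            · simp
            · by_cases he : l' = u :: t
              · subst he
                exact Or.inl (List.mem_cons_of_mem _ hw)
              · exact Or.inr ⟨l', ⟨he, hl'⟩, hw⟩
          · rintro (hw | ⟨l', ⟨-, hl'⟩, hw⟩)
            · rcases List.mem_cons.1 hw with rfl | hw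
              · exact Or.inl rfl
              · exact Or.inr ⟨_, hl, hw⟩
            · exact Or.inr ⟨_, hl', hw⟩)
        (by
          have hnew : ∀ l' ∈ Q.erase (u :: t), ∀ w, w ∈ v :: u :: t → w ∉ l' := by
            intro l' hl' w hw hwl'
            obtain ⟨hne, hl'Q⟩ := Finset.mem_erase.1 hl'
            rcases List.mem_cons.1 hw with rfl | hw
            · exact hvl _ hl'Q hwl'
            · exact h3 _ hl'Q _ hl hne w hwl' hw
          intro l₁ hl₁ l₂ hl₂ hne w hw₁ hw₂
          rcases Finset.mem_insert.1 hl₁ with rfl | hl₁ <;>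
            rcases Finset.mem_insert.1 hl₂ with rfl | hl₂
          · exact hne rfl
          · exact hnew _ hl₂ w hw₁ hw₂
          · exact hnew _ hl₁ w hw₂ hw₁
          · exact h3 _ (Finset.mem_of_mem_erase hl₁) _ (Finset.mem_of_mem_erase hl₂) hne w hw₁ hw₂)
        (by
          intro l' hl' w hw z hwz
          rw [Finset.mem_insert]
          rcases Finset.mem_insert.1 hl' with rfl | hl'
          · rcases List.mem_cons.1 hw with rfl | hw
            · by_cases hzv : z = v
              · exact Or.inl hzv
              · exact Or.inr (hrest z hwz hzv)
            · exact Or.inr (h4 _ hl w hw z hwz)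
          · exact Or.inr (h4 _ (Finset.mem_of_mem_erase hl') w hw z hwz))
      refine ⟨Q', hQ', hcard.trans ((Finset.card_insert_le _ _).trans ?_)⟩
      rw [Finset.card_erase_add_one hl]
  obtain ⟨Q, hQ, hc⟩ := key _ S.toFinset (S.toFinset.image fun v => [v]) rfl (by simp)
    (by simp) (by simp) (by simp) (by simp)
  refine ⟨Q, hQ, hc.trans (Finset.card_image_le.trans ?_)⟩
  rw [Set.ncard_eq_toFinset_card']

theorem IsMinPathCover.isMinZeroForcingSet [Fintype V] (hT : T.IsAcyclic) {P : Finset (List V)}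
    (hP : IsMinPathCover T P) : IsMinZeroForcingSet T (headSet P) := by
  refine ⟨hP.1.isZeroForcingSet hT, fun S' hS' => ?_⟩
  obtain ⟨Q, hQ, hc⟩ := hS'.exists_isPathCover hT
  exact (ncard_headSet_le P).trans ((hP.2 Q hQ).trans hc)

theorem IsPathCover.replace (hT : T.IsAcyclic) {P D D' : Finset (List V)} (hP : IsPathCover T P)
    (hD : D ⊆ P) (hpath : ∀ l ∈ D', l ≠ [] ∧ l.Nodup ∧ l.IsChain T.Adj)
    (hmem : ∀ v, (∃ l ∈ D', v ∈ l) ↔ ∃ l ∈ D, v ∈ l)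
    (hdisj : ∀ l ∈ D', ∀ l' ∈ D', l ≠ l' → ∀ v : V, v ∈ l → v ∉ l') :
    IsPathCover T (P \ D ∪ D') := by
  have hnew : ∀ l ∈ D', ∀ l' ∈ P \ D, ∀ v, v ∈ l → v ∉ l' := by
    intro l hl l' hl' v hv hv'
    obtain ⟨m, hm, hvm⟩ := (hmem v).1 ⟨l, hl, hv⟩
    obtain ⟨hl'P, hl'D⟩ := Finset.mem_sdiff.1 hl'
    exact hl'D (hP.eq_of_mem (hD hm) hl'P hvm hv' ▸ hm)
  refine ⟨fun l hl => ?_, fun v => ?_, fun l hl l' hl' hne v hv hv' => ?_⟩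
  · rcases Finset.mem_union.1 hl with hl | hl
    · exact hP.1 l (Finset.mem_sdiff.1 hl).1
    · exact (isInducedPath_iff hT).2 (hpath l hl)
  · obtain ⟨l, hl, hv⟩ := hP.2.1 v
    by_cases hlD : l ∈ D
    · obtain ⟨m, hm, hvm⟩ := (hmem v).2 ⟨l, hlD, hv⟩
      exact ⟨m, Finset.mem_union_right _ hm, hvm⟩
    · exact ⟨l, Finset.mem_union_left _ (Finset.mem_sdiff.2 ⟨hl, hlD⟩), hv⟩
  · rcases Finset.mem_union.1 hl with hl | hl <;> rcases Finset.mem_union.1 hl' with hl' | hl'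
    · exact hP.2.2 l (Finset.mem_sdiff.1 hl).1 l' (Finset.mem_sdiff.1 hl').1 hne v hv hv'
    · exact hnew _ hl' _ hl v hv' hv
    · exact hnew _ hl _ hl' v hv hv'
    · exact hdisj l hl l' hl' hne v hv hv'

theorem IsMinPathCover.card_le_of_replace (hT : T.IsAcyclic) {P D D' : Finset (List V)}
    (hP : IsMinPathCover T P)
    (hD : D ⊆ P) (hpath : ∀ l ∈ D', l ≠ [] ∧ l.Nodup ∧ l.IsChain T.Adj)
    (hmem : ∀ v, (∃ l ∈ D', v ∈ l) ↔ ∃ l ∈ D, v ∈ l)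
    (hdisj : ∀ l ∈ D', ∀ l' ∈ D', l ≠ l' → ∀ v : V, v ∈ l → v ∉ l') : D.card ≤ D'.card := by
  have h1 := hP.2 _ (hP.1.replace hT hD hpath hmem hdisj)
  have h2 := Finset.card_union_le (P \ D) D'
  rw [Finset.card_sdiff_of_subset hD] at h2
  have := Finset.card_le_card hD
  omega

theorem IsMinPathCover.replace (hT : T.IsAcyclic) {P D D' : Finset (List V)}
    (hP : IsMinPathCover T P)
    (hD : D ⊆ P) (hpath : ∀ l ∈ D', l ≠ [] ∧ l.Nodup ∧ l.IsChain T.Adj)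
    (hmem : ∀ v, (∃ l ∈ D', v ∈ l) ↔ ∃ l ∈ D, v ∈ l)
    (hdisj : ∀ l ∈ D', ∀ l' ∈ D', l ≠ l' → ∀ v : V, v ∈ l → v ∉ l') (hcard : D'.card ≤ D.card) :
    IsMinPathCover T (P \ D ∪ D') := by
  refine ⟨hP.1.replace hT hD hpath hmem hdisj, fun Q hQ => ?_⟩
  have h1 := hP.2 Q hQ
  have h2 := Finset.card_union_le (P \ D) D'
  rw [Finset.card_sdiff_of_subset hD] at h2
  have := Finset.card_le_card hD
  omega

theorem IsPathCover.spec (hT : T.IsAcyclic) {P : Finset (List V)} (hP : IsPathCover T P)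
    {l : List V} (hl : l ∈ P) : l ≠ [] ∧ l.Nodup ∧ l.IsChain T.Adj :=
  (isInducedPath_iff hT).1 (hP.1 l hl)

theorem IsMinPathCover.reverse (hT : T.IsAcyclic) {P : Finset (List V)}
    (hP : IsMinPathCover T P) {l : List V} (hl : l ∈ P) :
    IsMinPathCover T (P \ {l} ∪ {l.reverse}) := by
  obtain ⟨h1, h2, h3⟩ := hP.1.spec hT hl
  refine hP.replace hT (by simpa using hl) ?_ (by simp) ?_ (by simp)
  · simpa using ⟨h1, h2, h3.reverse_adj⟩
  · simp

theorem IsMinPathCover.sameOrbit [Fintype V] (hT : T.IsAcyclic) (hiso : IsoUniqueZF T)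
    {P : Finset (List V)} (hP : IsMinPathCover T P) {l : List V} (hl : l ∈ P) {a b : V}
    (ha : l.head? = some a) (hb : l.getLast? = some b) : SameOrbit T a b := by
  obtain ⟨φ, hφ⟩ := hiso _ _ (hP.isMinZeroForcingSet hT)
    ((hP.reverse hT hl).isMinZeroForcingSet hT)
  by_contra hab
  let O : Set V := {v | SameOrbit T a v}
  have hO : φ '' (headSet P ∩ O) = headSet (P \ {l} ∪ {l.reverse}) ∩ O := by
    rw [← hφ, Set.image_inter φ.injective]
    congr 1
    ext v
    constructor
    · rintro ⟨w, hw, rfl⟩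
      exact SameOrbit.trans hw ⟨φ, rfl⟩
    · intro hv
      exact ⟨φ.symm v, SameOrbit.trans hv ⟨φ.symm, rfl⟩, by simp⟩
  have hcard := Set.ncard_image_of_injective (headSet P ∩ O) φ.injective
  rw [hO] at hcard
  refine hcard.not_lt (Set.ncard_lt_ncard ?_ (Set.toFinite _))
  refine (Set.ssubset_iff_of_subset ?_).2 ⟨a, ⟨⟨l, hl, ha⟩, ⟨RelIso.refl _, rfl⟩⟩, ?_⟩
  · rintro v ⟨⟨m, hm, hv⟩, hvO⟩
    rcases Finset.mem_union.1 hm with hm | hm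
    · exact ⟨⟨m, (Finset.mem_sdiff.1 hm).1, hv⟩, hvO⟩
    · rw [Finset.mem_singleton.1 hm, List.head?_reverse, hb, Option.some_inj] at hv
      exact absurd (hv ▸ hvO) hab
  · rintro ⟨⟨m, hm, hv⟩, -⟩
    rcases Finset.mem_union.1 hm with hm | hm
    · obtain ⟨hmP, hml⟩ := Finset.mem_sdiff.1 hm
      exact hml (Finset.mem_singleton.2
        (hP.1.eq_of_mem hmP hl (List.mem_of_head? hv) (List.mem_of_head? ha)))
    · rw [Finset.mem_singleton.1 hm, List.head?_reverse, hb, Option.some_inj] at hv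
      exact hab (hv ▸ ⟨RelIso.refl _, rfl⟩)

/-- The path through the neighbor `y` of a singleton path `[x]` continues on both sides of `y`,
and its vertex before `y` lies in the orbit of `x`. -/
theorem IsMinPathCover.exists_sameOrbit_neighbor [Fintype V] (hT : T.IsAcyclic)
    (hiso : IsoUniqueZF T) {P : Finset (List V)} (hP : IsMinPathCover T P) {x y : V}
    (hx : [x] ∈ P) (hxy : T.Adj x y) {A B : List V} (hl : A ++ y :: B ∈ P) :
    ∃ A' a, A = A' ++ [a] ∧ SameOrbit T x a ∧ a ≠ x := by
  have hne : [x] ≠ A ++ y :: B := by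
    intro h
    have : y ∈ [x] := by simp [h]
    exact hxy.ne (List.mem_singleton.1 this).symm
  have hxl : x ∉ A ++ y :: B := fun h => hne (hP.1.eq_of_mem hx hl (by simp) h)
  obtain ⟨-, hnd, hch⟩ := hP.1.spec hT hl
  have hD : ({[x], A ++ y :: B} : Finset (List V)) ⊆ P := by
    simp [Finset.insert_subset_iff, hx, hl]
  have hDcard : ({[x], A ++ y :: B} : Finset (List V)).card = 2 := Finset.card_pair hne
  have hxB : (x :: y :: B) ≠ [] ∧ (x :: y :: B).Nodup ∧ (x :: y :: B).IsChain T.Adj :=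
    ⟨by simp, List.nodup_cons.2 ⟨fun h => hxl (by simp [List.mem_append, h]),
      (List.nodup_append.1 hnd).2.1⟩, List.isChain_cons_cons.2 ⟨hxy, hch.right_of_append⟩⟩
  rcases List.eq_nil_or_concat' A with rfl | ⟨A', a, rfl⟩
  · have := hP.card_le_of_replace (D' := {x :: y :: B}) hT hD (by simpa using hxB) (by simp)
      (by simp)
    rw [hDcard, Finset.card_singleton] at this
    omega
  · refine ⟨A', a, rfl, ?_, ?_⟩
    · have hdj : ∀ v, v ∈ A' ++ [a] → v ∉ x :: y :: B := by
        intro v hv hv'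
        rcases List.mem_cons.1 hv' with rfl | hv'
        · exact hxl (List.mem_append_left _ hv)
        · exact (List.nodup_append.1 hnd).2.2 v hv v hv' rfl
      have hP' := hP.replace (D' := {A' ++ [a], x :: y :: B}) hT hD
        (by
          intro l h
          rcases Finset.mem_insert.1 h with rfl | h
          · exact ⟨by simp, (List.nodup_append.1 hnd).1, hch.left_of_append⟩
          · rwa [Finset.mem_singleton.1 h])
        (by
          intro v
          simp only [Finset.mem_insert, Finset.mem_singleton, exists_eq_or_imp, exists_eq_left,
            List.mem_append, List.mem_cons]
          tauto)
        (by
          intro l h l' h' hll v hv hv'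
          simp only [Finset.mem_insert, Finset.mem_singleton] at h h'
          rcases h with rfl | rfl <;> rcases h' with rfl | rfl
          · exact hll rfl
          · exact hdj v hv hv'
          · exact hdj v hv' hv
          · exact hll rfl)
        (hDcard ▸ Finset.card_le_two)
      obtain ⟨h, hh⟩ : ∃ h, (A' ++ [a]).head? = some h := by
        cases A' <;> simp
      obtain ⟨e, he⟩ : ∃ e, (y :: B).getLast? = some e :=
        ⟨_, List.getLast?_eq_some_getLast (by simp)⟩
      have h1 : SameOrbit T h e := hP.sameOrbit hT hiso hl (by rw [List.head?_append, hh]; rfl) (by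
        rw [List.getLast?_append, he]; rfl)
      have h2 : SameOrbit T h a := hP'.sameOrbit hT hiso
        (Finset.mem_union_right _ (by simp)) hh (by simp)
      have h3 : SameOrbit T x e := hP'.sameOrbit hT hiso (l := x :: y :: B)
        (Finset.mem_union_right _ (by simp)) rfl (by rw [List.getLast?_cons_cons, he])
      exact h3.trans (h1.symm.trans h2)
    · rintro rfl
      simp at hxl

theorem IsMinPathCover.eq_of_adj_of_adj [Fintype V] (hT : T.IsAcyclic)
    (hiso : IsoUniqueZF T) {P : Finset (List V)} (hP : IsMinPathCover T P) {x : V}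
    (hx : [x] ∈ P) {o y z : V} (ho : SameOrbit T x o) (hoy : T.Adj o y) (hoz : T.Adj o z) :
    y = z := by
  have hstep : ∀ o, SameOrbit T x o → ∀ y, T.Adj o y →
      ∃ r, T.Adj y r ∧ r ≠ o ∧ SameOrbit T x r := by
    rintro _ ⟨φ, rfl⟩ y hy
    have hxy : T.Adj x (φ.symm y) := by
      rw [← φ.map_adj_iff]
      simpa using hy
    obtain ⟨l, hl, hyl⟩ := hP.1.2.1 (φ.symm y)
    obtain ⟨A, B, rfl⟩ := List.append_of_mem hyl
    obtain ⟨A', a, rfl, hxa, hne⟩ := hP.exists_sameOrbit_neighbor hT hiso hx hxy hl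
    have hch := (hP.1.spec hT hl).2.2
    rw [List.append_assoc] at hch
    have hay : T.Adj a (φ.symm y) := hch.right_of_append.rel
    refine ⟨φ a, ?_, fun h => hne (φ.injective h), hxa.trans ⟨φ, rfl⟩⟩
    rw [← φ.symm.map_adj_iff]
    simpa using hay.symm
  by_contra hyz
  have hbranch : ∀ o, SameOrbit T x o → ∀ s, ∃ y, T.Adj o y ∧ y ≠ s := by
    intro o' ho' s
    obtain ⟨φ, rfl⟩ := ho.symm.trans ho'
    by_cases h : φ y = s
    · exact ⟨φ z, φ.map_adj_iff.2 hoz, fun h' => hyz (φ.injective (h.trans h'.symm))⟩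
    · exact ⟨φ y, φ.map_adj_iff.2 hoy, h⟩
  refine SimpleGraph.false_of_extend (fun u _ p => p.IsPath ∧ SameOrbit T x u) (fun _ _ _ h => h.1) ?_
    (p := (Walk.nil : T.Walk o o)) ⟨Walk.IsPath.nil, ho⟩
  rintro u w p ⟨hp, hu⟩
  obtain ⟨y, hy, hys⟩ := hbranch u hu p.snd
  obtain ⟨r, hr, hru, hxr⟩ := hstep u hu y hy
  exact ⟨r, w, Walk.cons hr.symm (Walk.cons hy.symm p),
    ⟨hT.isPath_cons (hT.isPath_cons hp _ hys) _ (by simpa using hru), hxr⟩, by simp⟩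

theorem IsMinPathCover.exists_eq_singleton [Fintype V] (hT : T.IsAcyclic)
    (hiso : IsoUniqueZF T) {P : Finset (List V)} (hP : IsMinPathCover T P) {x y : V}
    (hx : [x] ∈ P) (hxy : T.Adj x y) {A B : List V} (hl : A ++ y :: B ∈ P) :
    ∃ a, A = [a] := by
  obtain ⟨A', a, rfl, hxa, -⟩ := hP.exists_sameOrbit_neighbor hT hiso hx hxy hl
  obtain ⟨-, hnd, hch⟩ := hP.1.spec hT hl
  rcases List.eq_nil_or_concat' A' with rfl | ⟨A'', c, rfl⟩
  · exact ⟨a, rfl⟩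
  · simp only [List.append_assoc, List.cons_append, List.nil_append] at hnd hch
    have hch' := hch.right_of_append
    have hcy : c = y := hP.eq_of_adj_of_adj hT hiso hx hxa hch'.rel.symm hch'.of_cons.rel
    have := (List.nodup_append.1 hnd).2.1
    simp [hcy] at this

end PathCover

/-- If a finite tree `T` is an iso-unique zero forcing graph, `P` is a minimum path cover
of `T`, and some path of `P` consists of the single vertex `x`, then the neighbor of `x`
in `T` is the middle vertex of a path of `P` with exactly three vertices. -/
theorem single_vertex_path_neighbor_is_center_of_P3 {V : Type*} [Fintype V] [DecidableEq V]
    (T : SimpleGraph V) (hT : T.IsTree) (hiso : IsoUniqueZF T)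
    (P : Finset (List V)) (hP : IsMinPathCover T P)
    (x : V) (hsingle : [x] ∈ P)
    (y : V) (hadj : T.Adj x y) :
    ∃ a b : V, [a, y, b] ∈ P := by
  obtain ⟨l, hl, hyl⟩ := hP.1.2.1 y
  obtain ⟨A, B, rfl⟩ := List.append_of_mem hyl
  obtain ⟨a, rfl⟩ := hP.exists_eq_singleton hT.isAcyclic hiso hsingle hadj hl
  obtain ⟨b, hb⟩ := (hP.reverse hT.isAcyclic hl).exists_eq_singleton hT.isAcyclic hiso
    (A := B.reverse) (B := [a])
    (Finset.mem_union_left _ (Finset.mem_sdiff.2 ⟨hsingle, by simp⟩)) hadj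
    (Finset.mem_union_right _ (by simp))
  obtain rfl : B = [b] := by simpa using congrArg List.reverse hb
  exact ⟨a, b, hl⟩
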